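/- arXiv:cs/0604045 — 6 statements merged into one kernel-verified Lean document; each statement's English description precedes it below -/
import Mathlib

section
/- If there exists a packing class for (V,w) — a d-tuple of edge sets E_1,…,E_d on the finite box set V such that (P1) each graph G_i=(V,E_i) is an interval graph, (P2) every stable set of G_i is x_i-feasible, and (P3) the intersection of all the E_i is empty — then V admits a packing into the unit container. -/
def IsIntervalGraph {V : Type*} (G : SimpleGraph V) : Prop :=
  ∃ lo hi : V → ℝ, (∀ v, lo v ≤ hi v) ∧
    ∀ u v : V, u ≠ v →
      (G.Adj u v ↔ (Set.Icc (lo u) (hi u) ∩ Set.Icc (lo v) (hi v)).Nonempty)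

def IsPackingClass {V : Type*} [Fintype V] {d : ℕ} (w : V → Fin d → ℝ)
    (G : Fin d → SimpleGraph V) : Prop :=
  (∀ i, IsIntervalGraph (G i)) ∧
  (∀ i : Fin d, ∀ S : Finset V,
      (∀ u ∈ S, ∀ v ∈ S, u ≠ v → ¬ (G i).Adj u v) → ∑ v ∈ S, w v i ≤ 1) ∧
  (∀ b c : V, ¬ ∀ i, (G i).Adj b c)

def IsPacking {V : Type*} {d : ℕ} (w p : V → Fin d → ℝ) : Prop :=
  (∀ v i, 0 ≤ p v i ∧ p v i + w v i ≤ 1) ∧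
  ∀ b c : V, b ≠ c → ∃ i,
    Set.Ico (p b i) (p b i + w b i) ∩ Set.Ico (p c i) (p c i + w c i) = ∅

def InSearchSpace {V : Type*} [Fintype V] {d : ℕ} (w : V → Fin d → ℝ)
    (Ep Em : Fin d → Set (Sym2 V)) (F : Fin d → SimpleGraph V) : Prop :=
  IsPackingClass w F ∧ ∀ j, Ep j ⊆ (F j).edgeSet ∧ (F j).edgeSet ⊆ (Em j)ᶜ

def IndistBoxes {V : Type*} {d : ℕ} (w : V → Fin d → ℝ)
    (Ep Em : Fin d → Set (Sym2 V)) (b c : V) : Prop :=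
  w b = w c ∧ ∀ i : Fin d, ∀ z : V, z ≠ b → z ≠ c →
    ((s(b, z) ∈ Ep i ↔ s(c, z) ∈ Ep i) ∧ (s(b, z) ∈ Em i ↔ s(c, z) ∈ Em i))

def IndistEdges {V : Type*} {d : ℕ} (w : V → Fin d → ℝ)
    (Ep Em : Fin d → Set (Sym2 V)) (e e' : Sym2 V) : Prop :=
  ∃ b c b' c' : V, e = s(b, c) ∧ e' = s(b', c') ∧
    IndistBoxes w Ep Em b b' ∧ IndistBoxes w Ep Em c c'

def PackingClassIso {V : Type*} {d : ℕ} (w : V → Fin d → ℝ)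
    (F F' : Fin d → SimpleGraph V) : Prop :=
  ∃ π : Equiv.Perm V, (∀ b, w (π b) = w b) ∧
    ∀ j b c, (F j).Adj b c ↔ (F' j).Adj (π b) (π c)

def IsComparability {V : Type*} (G : SimpleGraph V) : Prop :=
  ∃ F : Set (V × V), (∀ b c : V, G.Adj b c ↔ Xor' ((b, c) ∈ F) ((c, b) ∈ F)) ∧
    ∀ b c z : V, (b, c) ∈ F → (c, z) ∈ F → (b, z) ∈ F

def HasInducedC4 {V : Type*} (G : SimpleGraph V) : Prop :=
  ∃ b0 b1 b2 b3 : V, b0 ≠ b1 ∧ b0 ≠ b2 ∧ b0 ≠ b3 ∧ b1 ≠ b2 ∧ b1 ≠ b3 ∧ b2 ≠ b3 ∧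
    G.Adj b0 b1 ∧ G.Adj b1 b2 ∧ G.Adj b2 b3 ∧ G.Adj b3 b0 ∧
    ¬ G.Adj b0 b2 ∧ ¬ G.Adj b1 b3

def HasOdd2ChordlessCycle {V : Type*} (G : SimpleGraph V) : Prop :=
  ∃ k : ℕ, Odd k ∧ ∃ b : ZMod k → V,
    (∀ j, G.Adj (b j) (b (j + 1))) ∧ ∀ j, ¬ G.Adj (b j) (b (j + 2))

/-- Placing every box at the largest weight of a stable set lying entirely to its left packs an
interval graph with feasible stable sets into the unit interval. -/
theorem IsIntervalGraph.exists_packing_coordinate {V : Type*} [Fintype V] {G : SimpleGraph V}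
    (hG : IsIntervalGraph G) (w : V → ℝ)
    (hfeas : ∀ S : Finset V,
      (∀ u ∈ S, ∀ v ∈ S, u ≠ v → ¬ G.Adj u v) → ∑ v ∈ S, w v ≤ 1) :
    ∃ q : V → ℝ, (∀ v, 0 ≤ q v ∧ q v + w v ≤ 1) ∧
      ∀ b c, b ≠ c → ¬ G.Adj b c → q b + w b ≤ q c ∨ q c + w c ≤ q b := by
  classical
  obtain ⟨lo, hi, hle, hadj⟩ := hG
  have not_adj_of_lt {u v : V} (huv : u ≠ v) (h : hi u < lo v) : ¬ G.Adj u v := by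
    rw [hadj u v huv]
    rintro ⟨x, hx, hx'⟩
    linarith [hx.2, hx'.1]
  have lt_or_lt {u v : V} (huv : u ≠ v) (h : ¬ G.Adj u v) : hi u < lo v ∨ hi v < lo u := by
    by_contra! hcon
    exact h ((hadj u v huv).2
      ⟨max (lo u) (lo v), ⟨le_max_left _ _, max_le (hle u) hcon.1⟩,
        ⟨le_max_right _ _, max_le hcon.2 (hle v)⟩⟩)
  let T : V → Finset (Finset V) := fun v => Finset.univ.filter fun S =>
    (∀ u ∈ S, ∀ u' ∈ S, u ≠ u' → ¬ G.Adj u u') ∧ ∀ u ∈ S, hi u < lo v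
  have mem_T {v : V} {S : Finset V} : S ∈ T v ↔
      (∀ u ∈ S, ∀ u' ∈ S, u ≠ u' → ¬ G.Adj u u') ∧ ∀ u ∈ S, hi u < lo v := by
    simp [T]
  have empty_mem (v : V) : ∅ ∈ T v := by simp [mem_T]
  have insert_stable {v : V} {S : Finset V} (hS : S ∈ T v) :
      ∀ u ∈ insert v S, ∀ u' ∈ insert v S, u ≠ u' → ¬ G.Adj u u' := by
    obtain ⟨hst, hlt⟩ := mem_T.1 hS
    intro u hu u' hu' hne
    rcases Finset.mem_insert.1 hu with rfl | huS <;>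
      rcases Finset.mem_insert.1 hu' with rfl | huS'
    · exact absurd rfl hne
    · exact fun h => not_adj_of_lt hne.symm (hlt _ huS') h.symm
    · exact not_adj_of_lt hne (hlt _ huS)
    · exact hst u huS u' huS' hne
  have sum_insert {v : V} {S : Finset V} (hS : S ∈ T v) :
      ∑ u ∈ insert v S, w u = ∑ u ∈ S, w u + w v := by
    rw [Finset.sum_insert fun hv => absurd ((mem_T.1 hS).2 v hv) (hle v).not_gt, add_comm]
  let q : V → ℝ := fun v => (T v).sup' ⟨∅, empty_mem v⟩ fun S => ∑ u ∈ S, w u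
  have le_q {v : V} {S : Finset V} (hS : S ∈ T v) : ∑ u ∈ S, w u ≤ q v :=
    Finset.le_sup' (fun S => ∑ u ∈ S, w u) hS
  have exists_q (v : V) : ∃ S ∈ T v, q v = ∑ u ∈ S, w u := Finset.exists_mem_eq_sup' _ _
  have q_step {b c : V} (h : hi b < lo c) : q b + w b ≤ q c := by
    obtain ⟨S, hS, hq⟩ := exists_q b
    rw [hq, ← sum_insert hS]
    refine le_q (mem_T.2 ⟨insert_stable hS, fun u hu => ?_⟩)
    rcases Finset.mem_insert.1 hu with rfl | hu
    · exact h
    · linarith [(mem_T.1 hS).2 u hu, hle b]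
  refine ⟨q, fun v => ⟨by simpa using le_q (empty_mem v), ?_⟩, fun b c hbc hnadj => ?_⟩
  · obtain ⟨S, hS, hq⟩ := exists_q v
    rw [hq, ← sum_insert hS]
    exact hfeas _ (insert_stable hS)
  · exact (lt_or_lt hbc hnadj).imp q_step q_step

/-- a packing class for (V,w) yields a packing into the unit container. -/
theorem packingClass_gives_packing {V : Type*} [Fintype V] {d : ℕ}
    (w : V → Fin d → ℝ) (hw : ∀ v i, 0 ≤ w v i)
    (G : Fin d → SimpleGraph V) (hG : IsPackingClass w G) :
    ∃ p : V → Fin d → ℝ, IsPacking w p := by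
  choose q hq hsep using fun i => (hG.1 i).exists_packing_coordinate (fun v => w v i) (hG.2.1 i)
  refine ⟨fun v i => q i v, fun v i => hq i v, fun b c hbc => ?_⟩
  obtain ⟨i, hi⟩ := not_forall.1 (hG.2.2 b c)
  refine ⟨i, Set.eq_empty_iff_forall_notMem.2 ?_⟩
  rintro x ⟨⟨h₁, h₂⟩, h₃, h₄⟩
  rcases hsep i b c hbc hi with h | h <;> linarith
end

section
/- A cocomparability graph is an interval graph if and only if it does not contain the chordless cycle C_4 of length 4 as an induced subgraph. (Gilmore–Hoffman, 1964) -/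
theorem isIntervalGraph_iff_exists_le {V : Type*} (G : SimpleGraph V) :
    IsIntervalGraph G ↔ ∃ lo hi : V → ℝ, (∀ v, lo v ≤ hi v) ∧
      ∀ u v : V, u ≠ v → (G.Adj u v ↔ lo u ≤ hi v ∧ lo v ≤ hi u) := by
  unfold IsIntervalGraph
  refine exists_congr fun lo => exists_congr fun hi => and_congr_right fun h =>
    forall_congr' fun u => forall_congr' fun v => imp_congr_right fun _ => iff_congr Iff.rfl ?_
  rw [Set.Icc_inter_Icc, Set.nonempty_Icc, sup_le_iff, le_inf_iff, le_inf_iff]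
  have hu := h u
  have hv := h v
  tauto

theorem IsIntervalGraph.not_hasInducedC4 {V : Type*} {G : SimpleGraph V}
    (hG : IsIntervalGraph G) : ¬ HasInducedC4 G := by
  obtain ⟨lo, hi, -, h⟩ := (isIntervalGraph_iff_exists_le G).1 hG
  rintro ⟨a, b, c, d, hab, hac, had, hbc, hbd, hcd, h1, h2, h3, h4, h5, h6⟩
  rw [h _ _ hab] at h1
  rw [h _ _ hbc] at h2
  rw [h _ _ hcd] at h3
  rw [h _ _ had.symm] at h4
  rw [h _ _ hac, not_and_or, not_le, not_le] at h5
  rw [h _ _ hbd, not_and_or, not_le, not_le] at h6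
  rcases h5 with h5 | h5 <;> rcases h6 with h6 | h6 <;> linarith

/-- A comparability graph is the comparability graph of a strict order. -/
theorem IsComparability.exists_strictOrder {V : Type*} {G : SimpleGraph V}
    (hG : IsComparability G) :
    ∃ r : V → V → Prop, (∀ a, ¬ r a a) ∧ (∀ a b c, r a b → r b c → r a c) ∧
      ∀ a b, G.Adj a b ↔ r a b ∨ r b a := by
  obtain ⟨F, hF, ht⟩ := hG
  refine ⟨fun a b => (a, b) ∈ F ∧ (b, a) ∉ F, fun a h => h.2 h.1, ?_, hF⟩
  rintro a b c ⟨hab, hba⟩ ⟨hbc, hcb⟩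
  exact ⟨ht _ _ _ hab hbc, fun hca => hcb (ht _ _ _ hca hab)⟩

/-- An order whose incomparability graph has no induced four-cycle contains no `2 + 2`. -/
theorem rel_or_rel_of_not_hasInducedC4 {V : Type*} {G : SimpleGraph V} {r : V → V → Prop}
    (tr : ∀ a b c, r a b → r b c → r a c) (hr : ∀ a b, Gᶜ.Adj a b ↔ r a b ∨ r b a)
    (hC : ¬ HasInducedC4 G) {a b c d : V} (hab : r a b) (hcd : r c d) : r a d ∨ r c b := by
  by_contra! hn
  obtain ⟨had, hcb⟩ := hn
  have adj : ∀ x y, x ≠ y → ¬ r x y → ¬ r y x → G.Adj x y := fun x y hne h1 h2 => by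
    have := hr x y
    rw [SimpleGraph.compl_adj] at this
    tauto
  have nadj : ∀ x y, r x y → x ≠ y ∧ ¬ G.Adj x y := fun x y h => by
    simpa [SimpleGraph.compl_adj] using (hr x y).2 (Or.inl h)
  have hac : a ≠ c := by rintro rfl; exact had hcd
  have had' : a ≠ d := by rintro rfl; exact hcb (tr _ _ _ hcd hab)
  have hcb' : c ≠ b := by rintro rfl; exact had (tr _ _ _ hab hcd)
  have hbd : b ≠ d := by rintro rfl; exact had hab
  exact hC ⟨a, c, b, d, hac, (nadj _ _ hab).1, had', hcb', (nadj _ _ hcd).1, hbd,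
    adj _ _ hac (fun h => had (tr _ _ _ h hcd)) (fun h => hcb (tr _ _ _ h hab)),
    adj _ _ hcb' hcb (fun h => had (tr _ _ _ hab (tr _ _ _ h hcd))),
    adj _ _ hbd (fun h => had (tr _ _ _ hab h)) (fun h => hcb (tr _ _ _ hcd h)),
    adj _ _ had'.symm (fun h => hcb (tr _ _ _ hcd (tr _ _ _ h hab))) had,
    (nadj _ _ hab).2, (nadj _ _ hcd).2⟩

/-- A finite order containing no `2 + 2` is an interval order. -/
theorem exists_interval_representation {V : Type*} [Fintype V] {r : V → V → Prop}
    (irr : ∀ a, ¬ r a a) (h22 : ∀ a b c d, r a b → r c d → r a d ∨ r c b) :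
    ∃ lo hi : V → ℕ, (∀ v, lo v ≤ hi v) ∧ ∀ x y, r x y ↔ hi x < lo y := by
  classical
  let D : V → Finset V := fun x => {y | r y x}
  let N : V → Finset V := fun x => {y | ¬ r x y}
  have le_hi : ∀ x y, ¬ r x y → (D y).card ≤ (N x).sup fun z => (D z).card := fun x y h =>
    Finset.le_sup (f := fun z => (D z).card) (by simpa [N] using h)
  refine ⟨fun x => (D x).card, fun x => (N x).sup fun z => (D z).card,
    fun x => le_hi x x (irr x), fun x y => ⟨fun hxy => ?_, fun h => ?_⟩⟩
  · have hx : x ∈ D y := by simpa [D] using hxy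
    refine (Finset.sup_lt_iff (Finset.card_pos.2 ⟨x, hx⟩)).2 fun z hz => ?_
    have hxz : ¬ r x z := by simpa [N] using hz
    refine Finset.card_lt_card ((Finset.ssubset_iff_of_subset fun w hw => ?_).2
      ⟨x, hx, by simpa [D] using hxz⟩)
    have hwz : r w z := by simpa [D] using hw
    simpa [D] using (h22 _ _ _ _ hwz hxy).resolve_right hxz
  · by_contra hxy
    exact (le_hi x y hxy).not_gt h

/-- Gilmore–Hoffman 1964: a cocomparability graph is an interval
graph iff it contains no induced C₄. -/
theorem cocomparability_interval_iff_no_C4 {V : Type*} [Fintype V]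
    (G : SimpleGraph V) (hco : IsComparability Gᶜ) :
    IsIntervalGraph G ↔ ¬ HasInducedC4 G := by
  refine ⟨IsIntervalGraph.not_hasInducedC4, fun hC => ?_⟩
  obtain ⟨r, irr, tr, hr⟩ := hco.exists_strictOrder
  obtain ⟨lo, hi, hle, h⟩ := exists_interval_representation irr fun _ _ _ _ =>
    rel_or_rel_of_not_hasInducedC4 tr hr hC
  refine (isIntervalGraph_iff_exists_le G).2
    ⟨fun v => lo v, fun v => hi v, fun v => Nat.cast_le.2 (hle v), fun u v huv => ?_⟩
  have huv' := hr u v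
  rw [SimpleGraph.compl_adj, h, h, ← not_le, ← not_le] at huv'
  rw [Nat.cast_le, Nat.cast_le]
  tauto
end

section
/- A graph is a comparability graph if and only if it does not contain a 2-chordless cycle of odd length. (Ghouilà-Houri 1962, Gilmore–Hoffman 1964) -/
namespace SimpleGraph

variable {V : Type*} {G : SimpleGraph V}

/-- Two ordered edges force each other directly when they share their tail or their head and the
remaining endpoints are not adjacent. -/
def Forces (G : SimpleGraph V) (p q : V × V) : Prop :=
  G.Adj p.1 p.2 ∧ G.Adj q.1 q.2 ∧
    (p.1 = q.1 ∧ ¬ G.Adj p.2 q.2 ∨ p.2 = q.2 ∧ ¬ G.Adj p.1 q.1)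

/-- The equivalence relation generated by `Forces`, whose classes on edges are the implication
classes of the graph. -/
def SameClass (G : SimpleGraph V) : V × V → V × V → Prop :=
  Relation.ReflTransGen G.Forces

theorem Forces.symm {p q : V × V} (h : G.Forces p q) : G.Forces q p := by
  obtain ⟨h₁, h₂, h₃⟩ := h
  refine ⟨h₂, h₁, ?_⟩
  rwa [eq_comm, G.adj_comm q.2, eq_comm (a := q.2), G.adj_comm q.1]

theorem Forces.swap {p q : V × V} (h : G.Forces p q) : G.Forces p.swap q.swap :=
  ⟨h.1.symm, h.2.1.symm, h.2.2.symm⟩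

theorem SameClass.symm {p q : V × V} (h : G.SameClass p q) : G.SameClass q p := by
  induction h with
  | refl => exact .refl
  | tail _ hs ih => exact .head hs.symm ih

theorem SameClass.trans {p q r : V × V} (h : G.SameClass p q) (h' : G.SameClass q r) :
    G.SameClass p r :=
  Relation.ReflTransGen.trans h h'

theorem SameClass.swap {p q : V × V} (h : G.SameClass p q) : G.SameClass p.swap q.swap :=
  Relation.ReflTransGen.lift Prod.swap (fun _ _ => Forces.swap) _ _ h

theorem SameClass.adj {p q : V × V} (h : G.SameClass p q) (hp : G.Adj p.1 p.2) :
    G.Adj q.1 q.2 := by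
  induction h with
  | refl => exact hp
  | tail _ hs _ => exact hs.2.1

/-- The triangle lemma for implication classes. -/
theorem SameClass.triangle {a b c : V} {q : V × V} (hab : G.Adj a b) (hac : G.Adj a c)
    (hB : ¬ G.SameClass (b, c) (a, c)) (hC : ¬ G.SameClass (b, c) (b, a))
    (h : G.SameClass (b, c) q) :
    G.Adj a q.1 ∧ G.Adj a q.2 ∧ G.SameClass (a, b) (a, q.1) ∧ G.SameClass (a, c) (a, q.2) := by
  induction h with
  | refl => exact ⟨hab, hac, .refl, .refl⟩
  | @tail q r hq hs ih =>
    obtain ⟨hq₁, hq₂, hb, hc⟩ := ih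
    obtain ⟨q₁, q₂⟩ := q
    obtain ⟨r₁, r₂⟩ := r
    have hr : G.SameClass (b, c) (r₁, r₂) := .tail hq hs
    obtain ⟨-, hadj, ⟨h₁, h₂⟩ | ⟨h₁, h₂⟩⟩ := hs
    · obtain rfl : q₁ = r₁ := h₁
      have har : G.Adj a r₂ := by
        by_contra hn
        exact hC (.trans (.tail (c := (q₁, a)) hr ⟨hadj, hq₁.symm, .inl ⟨rfl, fun e => hn e.symm⟩⟩)
          hb.symm.swap)
      exact ⟨hq₁, har, hb, .tail hc ⟨hq₂, har, .inl ⟨rfl, h₂⟩⟩⟩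
    · obtain rfl : q₂ = r₂ := h₁
      have har : G.Adj a r₁ := by
        by_contra hn
        exact hB (.trans (.tail (c := (a, q₂)) hr ⟨hadj, hq₂, .inr ⟨rfl, fun e => hn e.symm⟩⟩) hc.symm)
      exact ⟨har, hq₂, .tail hb ⟨hq₁, har, .inl ⟨rfl, h₂⟩⟩, hc⟩

theorem SameClass.exists_walk {a b : V} {q : V × V} (hab : G.Adj a b)
    (h : G.SameClass (a, b) q) :
    ∃ n : ℕ, Even n ∧ ∃ v : ℕ → V, v 0 = a ∧ v 1 = b ∧ v n = q.1 ∧ v (n + 1) = q.2 ∧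
      (∀ j ≤ n, G.Adj (v j) (v (j + 1))) ∧ ∀ j < n, ¬ G.Adj (v j) (v (j + 2)) := by
  induction h with
  | refl =>
    refine ⟨0, Even.zero, fun j => if j = 0 then a else b, by simp, by simp, by simp, by simp,
      ?_, by simp⟩
    intro j hj
    simpa [Nat.le_zero.1 hj] using hab
  | @tail q r _ hs ih =>
    obtain ⟨n, hn, v, h0, h1, hv1, hv2, hadj, hch⟩ := ih
    refine ⟨n + 2, hn.add even_two,
      fun j => if j < n + 2 then v j else if j = n + 2 then r.1 else r.2,
      by simpa using h0, by simpa using h1, by simp, by simp, ?_, ?_⟩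
    · intro j hj
      rcases (by omega : j ≤ n ∨ j = n + 1 ∨ j = n + 2) with hj | rfl | rfl
      · have h₁ : j < n + 2 := by omega
        simpa [h₁, hj] using hadj j hj
      · have : G.Adj q.2 r.1 := by
          obtain ⟨e₁, e₂, ⟨e, _⟩ | ⟨e, _⟩⟩ := hs
          · rw [← e]; exact e₁.symm
          · rw [e]; exact e₂.symm
        simpa [hv2] using this
      · simpa using hs.2.1
    · intro j hj
      rcases (by omega : j < n ∨ j = n ∨ j = n + 1) with hj | rfl | rfl
      · have h₁ : j < n + 2 := by omega
        simpa [h₁, hj] using hch j hj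
      · have : ¬ G.Adj q.1 r.1 := by
          obtain ⟨_, _, ⟨e, _⟩ | ⟨_, e⟩⟩ := hs
          · rw [e]; exact G.irrefl
          · exact e
        simpa [hv1] using this
      · have : ¬ G.Adj q.2 r.2 := by
          obtain ⟨_, _, ⟨_, e⟩ | ⟨e, _⟩⟩ := hs
          · exact e
          · rw [e]; exact G.irrefl
        simpa [hv2] using this

theorem hasOdd2ChordlessCycle_of_sameClass_swap {a b : V} (hab : G.Adj a b)
    (h : G.SameClass (a, b) (b, a)) : HasOdd2ChordlessCycle G := by
  obtain ⟨n, hn, v, h0, h1, hv1, hv2, hadj, hch⟩ := h.exists_walk hab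
  have hn0 : n ≠ 0 := by
    rintro rfl
    exact hab.ne (h0.symm.trans hv1)
  have hn2 : 2 ≤ n := by
    obtain ⟨m, rfl⟩ := hn
    omega
  refine ⟨n + 1, hn.add_one, fun j => v j.val, fun j => ?_, fun j => ?_⟩
  · have hj := ZMod.val_lt j
    beta_reduce
    rw [ZMod.val_add, ZMod.val_one_eq_one_mod, Nat.mod_eq_of_lt (by omega : 1 < n + 1)]
    rcases (by omega : j.val < n ∨ j.val = n) with hlt | heq
    · rw [Nat.mod_eq_of_lt (by omega)]
      exact hadj _ hlt.le
    · rw [heq, Nat.mod_self, hv1, h0]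
      exact hab.symm
  · have hj := ZMod.val_lt j
    beta_reduce
    rw [ZMod.val_add, ZMod.val_two_eq_two_mod, Nat.mod_eq_of_lt (by omega : 2 < n + 1)]
    rcases (by omega : j.val + 1 < n ∨ j.val + 1 = n ∨ j.val = n) with hlt | heq | heq
    · rw [Nat.mod_eq_of_lt (by omega)]
      exact hch _ (by omega)
    · have := hch j.val (by omega)
      rw [show j.val + 2 = n + 1 by omega, Nat.mod_self, h0]
      rwa [show j.val + 2 = n + 1 by omega, hv2] at this
    · rw [heq, show n + 2 = 1 + (n + 1) by omega, Nat.add_mod_right,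
        Nat.mod_eq_of_lt (by omega), hv1, h1]
      exact G.irrefl

/-- The union of the implication class of an edge and the class of the reversed edge. -/
def colorClass (G : SimpleGraph V) (a b : V) : Set (V × V) :=
  {p | G.SameClass (a, b) p ∨ G.SameClass (b, a) p}

theorem colorClass_comm (a b : V) : G.colorClass a b = G.colorClass b a :=
  Set.ext fun _ => or_comm

theorem SameClass.colorClass_eq {a b c d : V} (h : G.SameClass (a, b) (c, d)) :
    G.colorClass a b = G.colorClass c d :=
  Set.ext fun _ => or_congr ⟨h.symm.trans, h.trans⟩ ⟨h.symm.swap.trans, h.swap.trans⟩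

/-- Consider a cyclic triangle in which no two edges have opposite implication classes. If the
smallest tail of the colour class of one edge is the tail of an edge of its own implication class,
then it cannot be at most the smallest tail of the colour class of the preceding edge, if that too
is the tail of an edge of its own implication class. -/
theorem not_cyclic_triangle_of_le {e : V → ℕ} (he : Function.Injective e)
    {a b c : V} {p q : V × V} (hab : G.Adj a b) (hbc : G.Adj b c) (hca : G.Adj c a)
    (hAB : ¬ G.SameClass (a, b) (c, b)) (hAC : ¬ G.SameClass (a, b) (a, c))
    (hBC : ¬ G.SameClass (b, c) (a, c))
    (hp : G.SameClass (a, b) p) (hq : G.SameClass (c, a) q)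
    (hq_min : ∀ r ∈ G.colorClass c a, e q.1 ≤ e r.1) (hpq : e p.1 ≤ e q.1) : False := by
  obtain ⟨i, j⟩ := p
  obtain ⟨m, x⟩ := q
  obtain ⟨hci, hcj, h₁, h₂⟩ := hp.triangle hca hbc.symm hAB hAC
  have hm : m = i := he (le_antisymm (hq_min (i, c) (.inr h₁.swap)) hpq)
  subst hm
  have hmj : G.Adj m j := hp.adj hab
  have h₃ := (h₁.symm.trans hq).triangle (a := j) hcj.symm hmj.symm
    (fun h => hAC (h₁.trans (h.trans hp.swap.symm)).swap.symm)
    (fun h => hBC (h₁.trans (h.trans h₂.symm)).swap.symm)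
  exact hAB (h₂.swap.trans (h₃.2.2.1.trans hp.swap.symm)).swap.symm

theorem isComparability_of_not_sameClass_swap [Finite V]
    (hG : ∀ a b, G.Adj a b → ¬ G.SameClass (a, b) (b, a)) : IsComparability G := by
  obtain ⟨N, ⟨f⟩⟩ := Finite.exists_equiv_fin V
  let e : V → ℕ := fun v => f v
  have he : Function.Injective e := Fin.val_injective.comp f.injective
  have hrep : ∀ S : Set (V × V), S.Nonempty → ∃ p ∈ S, ∀ r ∈ S, e p.1 ≤ e r.1 := fun S hS =>
    Set.exists_min_image S (fun p => e p.1) S.toFinite hS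
  choose rep hmem hle using hrep
  have hne (a b : V) : (G.colorClass a b).Nonempty := ⟨(a, b), .inl .refl⟩
  let m (a b : V) : V × V := rep _ (hne a b)
  have hm {a b c d : V} (h : G.colorClass a b = G.colorClass c d) : m a b = m c d := by
    simp only [m, h]
  let F : V → V → Prop := fun a b => G.Adj a b ∧ G.SameClass (a, b) (m a b)
  have hF_asymm {a b : V} (h : F a b) : ¬ F b a := fun h' =>
    hG a b h.1 (h.2.trans (hm (colorClass_comm b a) ▸ h'.2.symm))
  have hF_total {a b : V} (h : G.Adj a b) : F a b ∨ F b a :=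
    (hmem _ (hne a b) : m a b ∈ G.colorClass a b).imp (fun h' => ⟨h, h'⟩)
      (fun h' => ⟨h.symm, hm (colorClass_comm a b) ▸ h'⟩)
  have hF_class {a b c d : V} (h : F a b) (hs : G.SameClass (a, b) (c, d)) : F c d :=
    ⟨hs.adj h.1, hm hs.colorClass_eq ▸ hs.symm.trans h.2⟩
  have hF_cycle {a b c : V} (hab : F a b) (hbc : F b c) (hca : F c a) :
      e (m c a).1 < e (m a b).1 := by
    by_contra! hn
    exact not_cyclic_triangle_of_le he hab.1 hbc.1 hca.1
      (fun h => hF_asymm hbc (hF_class hab h)) (fun h => hF_asymm hca (hF_class hab h))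
      (fun h => hF_asymm hca (hF_class hbc h)) hab.2 hca.2 (hle _ (hne c a)) hn
  refine ⟨{p | F p.1 p.2}, fun a b => ⟨fun h => ?_, ?_⟩, fun a b c hab hbc => ?_⟩
  · exact (hF_total h).imp (fun h' => ⟨h', hF_asymm h'⟩) (fun h' => ⟨h', hF_asymm h'⟩)
  · rintro (⟨h, -⟩ | ⟨h, -⟩)
    exacts [h.1, h.1.symm]
  · change F a b at hab
    change F b c at hbc
    change F a c
    have hac : G.Adj a c := by
      by_contra hn
      exact hF_asymm hbc (hF_class hab (.single ⟨hab.1, hbc.1.symm, .inr ⟨rfl, hn⟩⟩))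
    refine (hF_total hac).resolve_right fun hca => ?_
    have h₁ := hF_cycle hab hbc hca
    have h₂ := hF_cycle hbc hca hab
    have h₃ := hF_cycle hca hab hbc
    omega

theorem not_hasOdd2ChordlessCycle (hG : IsComparability G) : ¬ HasOdd2ChordlessCycle G := by
  obtain ⟨F, hF, htrans⟩ := hG
  rintro ⟨k, hk, b, hadj, hchord⟩
  let P : ZMod k → Prop := fun j => (b j, b (j + 1)) ∈ F
  have hP (j : ZMod k) : P (j + 1) ↔ ¬ P j := by
    have h₁ := (hF _ _).1 (hadj j)
    have h₂ := (hF _ _).1 (hadj (j + 1))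
    have h₃ := mt (hF _ _).2 (hchord j)
    simp only [P]
    rw [add_assoc, one_add_one_eq_two] at h₂ ⊢
    refine ⟨fun hyz hxy => ?_, fun hxy => by_contra fun hyz => ?_⟩
    · have hxz := htrans _ _ _ hxy hyz
      have hzx := by_contra fun hzx => h₃ (.inl ⟨hxz, hzx⟩)
      have hzy := htrans _ _ _ hzx hxy
      exact h₂.elim (fun h => h.2 hzy) (fun h => h.2 hyz)
    · have hyx := (h₁.resolve_left fun h => hxy h.1).1
      have hzy := (h₂.resolve_left fun h => hyz h.1).1
      have hzx := htrans _ _ _ hzy hyx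
      have hxz := by_contra fun hxz => h₃ (.inr ⟨hzx, hxz⟩)
      exact hxy (htrans _ _ _ hxz hzy)
  have hcast (m : ℕ) : P (m : ZMod k) ↔ (Even m ↔ P 0) := by
    induction m with
    | zero => simp
    | succ m ih =>
      rw [Nat.cast_succ, hP, ih, Nat.even_add_one]
      tauto
  have := hcast k
  rw [ZMod.natCast_self] at this
  have hne := Nat.not_even_iff_odd.2 hk
  tauto

end SimpleGraph

/-- Ghouilà-Houri 1962, Gilmore–Hoffman 1964: a graph is a
comparability graph iff it contains no 2-chordless cycle of odd length. -/
theorem comparability_iff_no_odd_2chordless_cycle {V : Type*} [Fintype V]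
    (G : SimpleGraph V) :
    IsComparability G ↔ ¬ HasOdd2ChordlessCycle G := by
  refine ⟨SimpleGraph.not_hasOdd2ChordlessCycle, fun h => ?_⟩
  exact SimpleGraph.isComparability_of_not_sameClass_swap fun a b hab hs =>
    h (SimpleGraph.hasOdd2ChordlessCycle_of_sameClass_swap hab hs)
end

section
/- Let E = (E_+, E_-) be a search information on V and i ∈ {1,…,d}. If the graph (V, E_{-,i}) contains an odd cycle all of whose 2-chords (as pairs of vertices) lie in E_{+,i}, then the search space L(E) is empty, i.e., there is no packing class F with E_{+,j} ⊆ F_j ⊆ complement of E_{-,j} for all j. -/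
/-- If each step of a sequence flips a proposition, an odd number of steps flips it too. -/
theorem iff_not_of_odd_of_flip {R : Type*} [AddMonoidWithOne R] {P : R → Prop}
    (hP : ∀ j, P (j + 1) ↔ ¬ P j) {n : ℕ} (hn : Odd n) : P (n : R) ↔ ¬ P 0 := by
  have key : ∀ m : ℕ, P ((2 * m : ℕ) : R) ↔ P 0 := by
    intro m
    induction m with
    | zero => simp
    | succ m ih =>
      rw [Nat.mul_succ, ← Nat.add_assoc (2 * m) 1 1, Nat.cast_add_one, Nat.cast_add_one, hP, hP, not_not,
        ih]
  obtain ⟨m, rfl⟩ := hn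
  rw [Nat.cast_add_one, hP, key]

/-- In an interval graph, no closed walk of odd length in the complement has all its 2-chords
in the graph. -/
theorem IsIntervalGraph.not_odd_cycle {V : Type*} {G : SimpleGraph V} (hG : IsIntervalGraph G)
    {k : ℕ} (hk : Odd k) (b : ZMod k → V)
    (hne : ∀ j, b j ≠ b (j + 1)) (hcyc : ∀ j, ¬ G.Adj (b j) (b (j + 1)))
    (hch : ∀ j, G.Adj (b j) (b (j + 2))) : False := by
  obtain ⟨lo, hi, hle, hadj⟩ := hG
  have flip : ∀ j, hi (b (j + 1)) < lo (b (j + 1 + 1)) ↔ ¬ hi (b j) < lo (b (j + 1)) := by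
    intro j
    have separated : ∀ j, hi (b j) < lo (b (j + 1)) ∨ hi (b (j + 1)) < lo (b j) := by
      intro j
      by_contra! h
      exact hcyc j ((hadj _ _ (hne j)).2 ⟨max (lo (b j)) (lo (b (j + 1))),
        ⟨le_max_left _ _, max_le (hle _) h.1⟩, ⟨le_max_right _ _, max_le h.2 (hle _)⟩⟩)
    have h2 : j + 1 + 1 = j + 2 := by ring
    obtain ⟨x, hx, hx'⟩ := (hadj _ _ (hch j).ne).1 (hch j)
    have s0 := separated j
    have s1 := separated (j + 1)
    rw [h2] at s1 ⊢
    have l0 := hle (b j)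
    have l1 := hle (b (j + 1))
    have l2 := hle (b (j + 2))
    obtain ⟨hx1, hx2⟩ := hx
    obtain ⟨hx3, hx4⟩ := hx'
    constructor
    · intro h h'
      linarith
    · intro h
      have h' := s0.resolve_left h
      refine s1.resolve_right fun h'' => ?_
      linarith
  have := iff_not_of_odd_of_flip (P := fun j => hi (b j) < lo (b (j + 1))) flip hk
  rw [ZMod.natCast_self] at this
  exact iff_not_self this


/-- an odd cycle in (V, E₋ᵢ) all of whose 2-chords lie in E₊ᵢ
empties the search space. -/
theorem oddCycle_2chords_fixed_empty {V : Type*} [Fintype V] {d : ℕ}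
    (w : V → Fin d → ℝ) (Ep Em : Fin d → Set (Sym2 V)) (i : Fin d)
    (k : ℕ) (hk : Odd k) (b : ZMod k → V)
    (hcyc : ∀ j : ZMod k, b j ≠ b (j + 1) ∧ s(b j, b (j + 1)) ∈ Em i)
    (hch : ∀ j : ZMod k, s(b j, b (j + 2)) ∈ Ep i) :
    ¬ ∃ F : Fin d → SimpleGraph V, InSearchSpace w Ep Em F := by
  rintro ⟨F, ⟨hI, -, -⟩, hE⟩
  exact (hI i).not_odd_cycle hk b (fun j => (hcyc j).1)
    (fun j h => (hE i).2 h (hcyc j).2) (fun j => (hE i).1 (hch j))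
end

section
/- Let E = (E_+, E_-) be a search information on V and i ∈ {1,…,d}. Suppose the graph (V, E_{+,i}) contains an induced C_4 on vertices b_0, b_1, b_2, b_3 (edges b_0b_1, b_1b_2, b_2b_3, b_3b_0 in E_{+,i}) for which one of the two chords, say b_0b_2, lies in E_{-,i}. Then every packing class F in the search space L(E) contains the other chord b_1b_3 in its i-th component: b_1b_3 ∈ F_i. Consequently, the augmentation adding b_1b_3 to E_{+,i} does not change the search space, while adding b_1b_3 to E_{-,i} makes the search space empty. -/
/-- In an interval graph, a 4-cycle missing one chord has the other one. -/
theorem IsIntervalGraph.adj_of_not_adj {V : Type*} {G : SimpleGraph V}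
    (hG : IsIntervalGraph G) {a b c e : V} (hac : a ≠ c) (hbe : b ≠ e)
    (hab : G.Adj a b) (hbc : G.Adj b c) (hce : G.Adj c e) (hea : G.Adj e a)
    (hn : ¬ G.Adj a c) : G.Adj b e := by
  obtain ⟨lo, hi, hle, hadj⟩ := hG
  have adj_iff : ∀ u v : V, u ≠ v → (G.Adj u v ↔ lo u ≤ hi v ∧ lo v ≤ hi u) := by
    intro u v huv
    rw [hadj u v huv, Set.Icc_inter_Icc, Set.nonempty_Icc, sup_le_iff, le_inf_iff, le_inf_iff]
    have hu := hle u
    have hv := hle v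
    tauto
  rw [adj_iff _ _ hab.ne] at hab
  rw [adj_iff _ _ hbc.ne] at hbc
  rw [adj_iff _ _ hce.ne] at hce
  rw [adj_iff _ _ hea.ne] at hea
  rw [adj_iff _ _ hac] at hn
  rw [adj_iff _ _ hbe]
  grind


/-- an induced C₄ in (V, E₊ᵢ) with chord b0b2 in E₋ᵢ forces the
other chord b1b3 into the i-th component of every packing class in the search
space; adding b1b3 to E₊ᵢ keeps the search space, adding it to E₋ᵢ empties it. -/
theorem inducedC4_forces_other_chord {V : Type*} [Fintype V] {d : ℕ}
    (w : V → Fin d → ℝ) (Ep Em : Fin d → Set (Sym2 V)) (i : Fin d)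
    (b0 b1 b2 b3 : V)
    (hd01 : b0 ≠ b1) (hd02 : b0 ≠ b2) (hd03 : b0 ≠ b3)
    (hd12 : b1 ≠ b2) (hd13 : b1 ≠ b3) (hd23 : b2 ≠ b3)
    (he01 : s(b0, b1) ∈ Ep i) (he12 : s(b1, b2) ∈ Ep i)
    (he23 : s(b2, b3) ∈ Ep i) (he30 : s(b3, b0) ∈ Ep i)
    (hn02 : s(b0, b2) ∉ Ep i) (hn13 : s(b1, b3) ∉ Ep i)
    (hm02 : s(b0, b2) ∈ Em i) :
    (∀ F : Fin d → SimpleGraph V, InSearchSpace w Ep Em F →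
      s(b1, b3) ∈ (F i).edgeSet) ∧
    (∀ F : Fin d → SimpleGraph V,
      InSearchSpace w (Function.update Ep i (Ep i ∪ {s(b1, b3)})) Em F ↔
        InSearchSpace w Ep Em F) ∧
    (¬ ∃ F : Fin d → SimpleGraph V,
      InSearchSpace w Ep (Function.update Em i (Em i ∪ {s(b1, b3)})) F) := by
  have forced : ∀ F : Fin d → SimpleGraph V, InSearchSpace w Ep Em F →
      s(b1, b3) ∈ (F i).edgeSet := by
    rintro F ⟨hF, hE⟩
    obtain ⟨hp, hm⟩ := hE i
    exact (hF.1 i).adj_of_not_adj hd02 hd13 (hp he01) (hp he12) (hp he23) (hp he30)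
      fun h => hm h hm02
  refine ⟨forced, fun F => ⟨fun ⟨hF, hE⟩ => ⟨hF, fun j => ⟨?_, (hE j).2⟩⟩,
    fun h => ⟨h.1, fun j => ⟨?_, (h.2 j).2⟩⟩⟩, ?_⟩
  · have hp := (hE j).1
    rcases eq_or_ne j i with rfl | hj
    · rw [Function.update_self] at hp
      exact Set.subset_union_left.trans hp
    · rwa [Function.update_of_ne hj] at hp
  · rcases eq_or_ne j i with rfl | hj
    · rw [Function.update_self]
      exact Set.union_subset (h.2 j).1 (Set.singleton_subset_iff.2 (forced F h))
    · rw [Function.update_of_ne hj]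
      exact (h.2 j).1
  · rintro ⟨F, hF, hE⟩
    have hmem : InSearchSpace w Ep Em F := by
      refine ⟨hF, fun j => ⟨(hE j).1, ?_⟩⟩
      have hm := (hE j).2
      rcases eq_or_ne j i with rfl | hj
      · rw [Function.update_self] at hm
        exact hm.trans (Set.compl_subset_compl.2 Set.subset_union_left)
      · rwa [Function.update_of_ne hj] at hm
    have hm := (hE i).2
    rw [Function.update_self] at hm
    exact hm (forced F hmem) (Or.inr rfl)
end

section
/- Let E = (E_+, E_-) be a search information on V, let i ∈ {1,…,d}, and let e' be a vertex pair with e' ∉ E_{+,i} and e' ∉ E_{-,i}. Suppose there is a set B ⊆ V such that: (1) B contains both vertices of e'; (2) every pair of distinct vertices of B that does not lie in E_{-,i} is an edge indistinguishable from e' with respect to E; and (3) B is x_i-infeasible (∑_{v∈B} w_i(v) > 1). Then the augmentation (e',+,i) is feasible: if the search space L(E) is nonempty, then there exists a packing class F ∈ L(E) with e' ∈ F_i. -/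
section Transposition

variable {V : Type*} {d : ℕ} {w : V → Fin d → ℝ} {Ep Em : Fin d → Set (Sym2 V)}

theorem IsIntervalGraph.comap_perm {G : SimpleGraph V} (hG : IsIntervalGraph G)
    (σ : Equiv.Perm V) : IsIntervalGraph (G.comap σ) := by
  obtain ⟨lo, hi, hle, hadj⟩ := hG
  exact ⟨lo ∘ σ, hi ∘ σ, fun v => hle (σ v), fun u v huv => hadj (σ u) (σ v) (σ.injective.ne huv)⟩

theorem IsPackingClass.comap_perm [Fintype V] {F : Fin d → SimpleGraph V}
    (hF : IsPackingClass w F) (σ : Equiv.Perm V) (hσ : ∀ v, w (σ v) = w v) :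
    IsPackingClass w (fun j => (F j).comap σ) := by
  obtain ⟨h₁, h₂, h₃⟩ := hF
  refine ⟨fun i => (h₁ i).comap_perm σ, fun i S hS => ?_, fun b c => h₃ (σ b) (σ c)⟩
  have h := h₂ i (S.map σ.toEmbedding) (by
    simp only [Finset.mem_map_equiv]
    intro u hu v hv huv
    simpa using hS _ hu _ hv (σ.symm.injective.ne huv))
  simpa [Finset.sum_map, hσ] using h

/-- An automorphism of the sizes and of the search information acts on the search space. -/
theorem InSearchSpace.comap_perm [Fintype V] {F : Fin d → SimpleGraph V}
    (hF : InSearchSpace w Ep Em F) (σ : Equiv.Perm V) (hσ : ∀ v, w (σ v) = w v)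
    (hE : ∀ j u v, u ≠ v → (s(u, v) ∈ Ep j → s(σ u, σ v) ∈ Ep j) ∧
      (s(u, v) ∈ Em j → s(σ u, σ v) ∈ Em j)) :
    InSearchSpace w Ep Em (fun j => (F j).comap σ) := by
  refine ⟨hF.1.comap_perm σ hσ, fun j => ⟨fun e => ?_, fun e => ?_⟩⟩
  · induction e using Sym2.ind with
    | _ u v =>
      intro he
      have huv : (F j).Adj u v := (hF.2 j).1 he
      exact (hF.2 j).1 ((hE j u v huv.ne).1 he)
  · induction e using Sym2.ind with
    | _ u v =>
      intro he hem
      have huv : ((F j).comap σ).Adj u v := he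
      exact (hF.2 j).2 (show s(σ u, σ v) ∈ (F j).edgeSet from he) ((hE j u v huv.ne).2 hem)

open Classical in
theorem Sym2.mem_of_swap_of_forall {E : Set (Sym2 V)} {b c : V}
    (h : ∀ z, z ≠ b → z ≠ c → (s(b, z) ∈ E ↔ s(c, z) ∈ E)) {u v : V} (huv : u ≠ v)
    (he : s(u, v) ∈ E) : s(Equiv.swap b c u, Equiv.swap b c v) ∈ E := by
  have hs : ∀ x y : V, s(x, y) = s(y, x) := fun _ _ => Sym2.eq_swap
  simp only [Equiv.swap_apply_def]
  split_ifs <;> grind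

open Classical in
theorem InSearchSpace.comap_swap [Fintype V] {F : Fin d → SimpleGraph V}
    (hF : InSearchSpace w Ep Em F) {b c : V} (hbc : IndistBoxes w Ep Em b c) :
    InSearchSpace w Ep Em (fun j => (F j).comap (Equiv.swap b c)) := by
  refine hF.comap_perm _ (fun v => ?_) fun j u v huv =>
    ⟨Sym2.mem_of_swap_of_forall (fun z hb hc => (hbc.2 j z hb hc).1) huv,
      Sym2.mem_of_swap_of_forall (fun z hb hc => (hbc.2 j z hb hc).2) huv⟩
  have h := hbc.1
  simp only [Equiv.swap_apply_def]
  split_ifs <;> simp_all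

theorem InSearchSpace.exists_adj_of_indistBoxes_of_ne [Fintype V] {F : Fin d → SimpleGraph V}
    (hF : InSearchSpace w Ep Em F) {i : Fin d} {p q p' q' : V} (hpq : (F i).Adj p q)
    (hp : IndistBoxes w Ep Em p p') (hq : IndistBoxes w Ep Em q q') (hne : p' ≠ q')
    (hqp : q ≠ p') :
    ∃ F' : Fin d → SimpleGraph V, InSearchSpace w Ep Em F' ∧ (F' i).Adj p' q' := by
  classical
  refine ⟨_, (hF.comap_swap hp).comap_swap hq, ?_⟩
  simpa [Equiv.swap_apply_of_ne_of_ne hqp.symm hne,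
    Equiv.swap_apply_of_ne_of_ne hpq.ne' hqp] using hpq

/-- An edge of a packing class can be moved to any other edge with indistinguishable ends. -/
theorem InSearchSpace.exists_adj_of_indistBoxes [Fintype V] {F : Fin d → SimpleGraph V}
    (hF : InSearchSpace w Ep Em F) {i : Fin d} {p q p' q' : V} (hpq : (F i).Adj p q)
    (hp : IndistBoxes w Ep Em p p') (hq : IndistBoxes w Ep Em q q') (hne : p' ≠ q') :
    ∃ F' : Fin d → SimpleGraph V, InSearchSpace w Ep Em F' ∧ (F' i).Adj p' q' := by
  by_cases hqp : q = p'
  · by_cases hpq' : p = q'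
    · subst hqp hpq'
      exact ⟨F, hF, hpq.symm⟩
    · obtain ⟨F', hF', h⟩ :=
        hF.exists_adj_of_indistBoxes_of_ne hpq.symm hq hp hne.symm hpq'
      exact ⟨F', hF', h.symm⟩
  · exact hF.exists_adj_of_indistBoxes_of_ne hpq hp hq hne hqp

end Transposition

/-- if B contains the vertices of e', every non-excluded pair in B
is indistinguishable from e', and B is x_i-infeasible, then the augmentation
(e',+,i) is feasible. -/
theorem infeasible_set_forces_edge {V : Type*} [Fintype V] {d : ℕ}
    (w : V → Fin d → ℝ) (Ep Em : Fin d → Set (Sym2 V)) (i : Fin d)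
    (b' c' : V) (hb'c' : b' ≠ c')
    (hep : s(b', c') ∉ Ep i) (hem : s(b', c') ∉ Em i)
    (B : Finset V) (hb'B : b' ∈ B) (hc'B : c' ∈ B)
    (hind : ∀ x ∈ B, ∀ y ∈ B, x ≠ y → s(x, y) ∉ Em i →
      IndistEdges w Ep Em s(x, y) s(b', c'))
    (hinf : 1 < ∑ v ∈ B, w v i)
    (hne : ∃ F : Fin d → SimpleGraph V, InSearchSpace w Ep Em F) :
    ∃ F : Fin d → SimpleGraph V,
      InSearchSpace w Ep Em F ∧ s(b', c') ∈ (F i).edgeSet := by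
  obtain ⟨F, hF⟩ := hne
  obtain ⟨x, hx, y, hy, hxy, hadj⟩ : ∃ x ∈ B, ∃ y ∈ B, x ≠ y ∧ (F i).Adj x y := by
    by_contra! h
    exact (hF.1.2.1 i B h).not_gt hinf
  obtain ⟨p, q, p', q', he, he', hp, hq⟩ :=
    hind x hx y hy hxy ((hF.2 i).2 (show s(x, y) ∈ (F i).edgeSet from hadj))
  have hpq : s(p, q) ∈ (F i).edgeSet := he ▸ hadj
  have hne' : p' ≠ q' := by
    rintro rfl
    exact hb'c' (Sym2.mk_isDiag_iff.1 (he' ▸ Sym2.mk_isDiag_iff.2 rfl))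
  obtain ⟨F', hF', h⟩ := hF.exists_adj_of_indistBoxes hpq hp hq hne'
  exact ⟨F', hF', he' ▸ h⟩
end
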